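/- Let A, L, Γ, α, Ω_r, K, M_r, N_r, Q_r satisfy all hypotheses (a), (b), (c) of the Main Theorem, with Q_r(x) > 0 for all x, r > 0. Assume in addition: (d) for every φ ∈ C_c^∞(ℝⁿ, ℝ) and every x ∈ ℝⁿ, ∫_{ℝⁿ} Γ(x,y) Lφ(y) dy = −φ(x) (Γ is a fundamental solution of L); and (e) for every continuous v : ℝⁿ → ℝ, one has lim_{r→0⁺} (M_r(v)(x) − v(x))/Q_r(x) = 0 for every x ∈ ℝⁿ if and only if v is C^∞ and satisfies Lv = 0 pointwise. Then for every pair of compactly supported continuous functions f, u : ℝⁿ → ℝ, the following are equivalent: (1) lim_{r→0⁺} (M_r(u)(x) − u(x))/Q_r(x) = −f(x) for every x ∈ ℝⁿ (u is an asymptotic average solution of L_a u = −f); (2) ∫_{ℝⁿ} u(y) Lφ(y) dy = −∫_{ℝⁿ} f(y) φ(y) dy for every φ ∈ C_c^∞(ℝⁿ, ℝ) (Lu = −f in the sense of distributions). -/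

import Mathlib

open MeasureTheory Filter Topology Metric

/-- The `L`-ball `Ω_r(x) := {y ≠ x : Γ(x,y) > 1/r} ∪ {x}`. -/
def LBall {n : ℕ} (Γ : EuclideanSpace ℝ (Fin n) → EuclideanSpace ℝ (Fin n) → ℝ)
    (x : EuclideanSpace ℝ (Fin n)) (r : ℝ) : Set (EuclideanSpace ℝ (Fin n)) :=
  {y | y ≠ x ∧ 1 / r < Γ x y} ∪ {x}

/-- The partial derivative `∂_i g` in the `i`-th coordinate direction. -/
noncomputable def pd {n : ℕ} (i : Fin n) (g : EuclideanSpace ℝ (Fin n) → ℝ)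
    (x : EuclideanSpace ℝ (Fin n)) : ℝ :=
  fderiv ℝ g x (EuclideanSpace.single i 1)

/-- The divergence-form operator `L u = Σ_{i,j} ∂_i (a_{ij} ∂_j u)`. -/
noncomputable def Lop {n : ℕ} (A : EuclideanSpace ℝ (Fin n) → Matrix (Fin n) (Fin n) ℝ)
    (u : EuclideanSpace ℝ (Fin n) → ℝ) (x : EuclideanSpace ℝ (Fin n)) : ℝ :=
  ∑ i : Fin n, ∑ j : Fin n, pd i (fun z => A z i j * pd j u z) x

/-- The kernel `K(x,y) = ⟨A(y)∇_yΓ(x,y), ∇_yΓ(x,y)⟩ / Γ(x,y)^{α+2}`. -/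
noncomputable def Kker {n : ℕ} (Γ : EuclideanSpace ℝ (Fin n) → EuclideanSpace ℝ (Fin n) → ℝ)
    (A : EuclideanSpace ℝ (Fin n) → Matrix (Fin n) (Fin n) ℝ) (α : ℝ)
    (x y : EuclideanSpace ℝ (Fin n)) : ℝ :=
  (∑ i : Fin n, ∑ j : Fin n, A y i j * pd i (fun z => Γ x z) y * pd j (fun z => Γ x z) y)
    / Γ x y ^ (α + 2)

/-- `M_r(u)(x) := ((α+1)/r^{α+1}) ∫_{Ω_r(x)} u(y) K(x,y) dy`. -/
noncomputable def Mr {n : ℕ} (Γ : EuclideanSpace ℝ (Fin n) → EuclideanSpace ℝ (Fin n) → ℝ)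
    (A : EuclideanSpace ℝ (Fin n) → Matrix (Fin n) (Fin n) ℝ) (α : ℝ)
    (u : EuclideanSpace ℝ (Fin n) → ℝ) (x : EuclideanSpace ℝ (Fin n)) (r : ℝ) : ℝ :=
  ((α + 1) / r ^ (α + 1)) * ∫ y in LBall Γ x r, u y * Kker Γ A α x y

/-- `N_r(w)(x) := ((α+1)/r^{α+1}) ∫₀^r ρ^α (∫_{Ω_ρ(x)} (Γ(x,y) − 1/ρ) w(y) dy) dρ`. -/
noncomputable def Nr {n : ℕ} (Γ : EuclideanSpace ℝ (Fin n) → EuclideanSpace ℝ (Fin n) → ℝ)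
    (α : ℝ) (w : EuclideanSpace ℝ (Fin n) → ℝ) (x : EuclideanSpace ℝ (Fin n)) (r : ℝ) : ℝ :=
  ((α + 1) / r ^ (α + 1)) *
    ∫ ρ in (0 : ℝ)..r, ρ ^ α * ∫ y in LBall Γ x ρ, (Γ x y - 1 / ρ) * w y

/-- `Q_r(x) := N_r(1)(x)`. -/
noncomputable def Qr {n : ℕ} (Γ : EuclideanSpace ℝ (Fin n) → EuclideanSpace ℝ (Fin n) → ℝ)
    (α : ℝ) (x : EuclideanSpace ℝ (Fin n)) (r : ℝ) : ℝ :=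
  Nr Γ α (fun _ => 1) x r

/-- The potential `u_g(x) := ∫_{ℝⁿ} Γ(x,y) g(y) dy`. -/
noncomputable def potential {n : ℕ}
    (Γ : EuclideanSpace ℝ (Fin n) → EuclideanSpace ℝ (Fin n) → ℝ)
    (g : EuclideanSpace ℝ (Fin n) → ℝ) (x : EuclideanSpace ℝ (Fin n)) : ℝ :=
  ∫ y, Γ x y * g y

/-- The qualitative regularity properties of a kernel `Γ` defined off the diagonal: continuity,
symmetry, positivity, blow-up at the pole, uniform decay at infinity and local integrability. -/
structure IsDecayingKernel {n : ℕ}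
    (Γ : EuclideanSpace ℝ (Fin n) → EuclideanSpace ℝ (Fin n) → ℝ) : Prop where
  continuousOn : ContinuousOn
    (fun p : EuclideanSpace ℝ (Fin n) × EuclideanSpace ℝ (Fin n) => Γ p.1 p.2) {p | p.1 ≠ p.2}
  symm : ∀ x y, x ≠ y → Γ x y = Γ y x
  pos : ∀ x y, x ≠ y → 0 < Γ x y
  blowup : ∀ y, Tendsto (fun x => Γ x y) (𝓝[≠] y) atTop
  decay : ∀ K : Set (EuclideanSpace ℝ (Fin n)), IsCompact K →
    Tendsto (fun x => ⨆ y : K, Γ x (y : EuclideanSpace ℝ (Fin n))) (cocompact _) (𝓝 0)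
  locallyIntegrable : ∀ x, LocallyIntegrable (Γ x) volume

namespace IsDecayingKernel

variable {n : ℕ} {Γ : EuclideanSpace ℝ (Fin n) → EuclideanSpace ℝ (Fin n) → ℝ}

theorem continuousOn_right (h : IsDecayingKernel Γ) (x : EuclideanSpace ℝ (Fin n)) :
    ContinuousOn (Γ x) {x}ᶜ :=
  h.continuousOn.comp (f := fun y => (x, y)) (by fun_prop) fun _ hy => Ne.symm hy

theorem measurable_right (h : IsDecayingKernel Γ) (x : EuclideanSpace ℝ (Fin n)) :
    Measurable (Γ x) :=
  measurable_of_continuousOn_compl_singleton x (h.continuousOn_right x)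

theorem blowup_right (h : IsDecayingKernel Γ) (x : EuclideanSpace ℝ (Fin n)) :
    Tendsto (Γ x) (𝓝[≠] x) atTop :=
  (h.blowup x).congr' (eventually_nhdsWithin_of_forall fun y hy => h.symm y x hy)

theorem eventually_lt_of_isCompact (h : IsDecayingKernel Γ)
    {K : Set (EuclideanSpace ℝ (Fin n))} (hK : IsCompact K) {ε : ℝ} (hε : 0 < ε) :
    ∀ᶠ x in cocompact (EuclideanSpace ℝ (Fin n)), ∀ y ∈ K, Γ x y < ε := by
  filter_upwards [(h.decay K hK).eventually_lt_const hε, hK.compl_mem_cocompact] with x hx hxK y hy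
  have hc : ContinuousOn (Γ x) K :=
    (h.continuousOn_right x).mono fun z hz => by rintro rfl; exact hxK hz
  have hb : BddAbove (Set.range fun y : K => Γ x y) := by
    have := hK.bddAbove_image hc
    rwa [Set.image_eq_range] at this
  exact (le_ciSup hb ⟨y, hy⟩).trans_lt hx

theorem eventually_lt (h : IsDecayingKernel Γ) (x : EuclideanSpace ℝ (Fin n)) {ε : ℝ}
    (hε : 0 < ε) : ∀ᶠ y in cocompact (EuclideanSpace ℝ (Fin n)), Γ x y < ε := by
  filter_upwards [h.eventually_lt_of_isCompact (isCompact_singleton (x := x)) hε,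
    (isCompact_singleton (x := x)).compl_mem_cocompact] with y hy hyx
  rw [h.symm x y (Ne.symm hyx)]
  exact hy x rfl

theorem exists_isCompact_superset_LBall (h : IsDecayingKernel Γ) (x : EuclideanSpace ℝ (Fin n))
    {r : ℝ} (hr : 0 < r) : ∃ K, IsCompact K ∧ LBall Γ x r ⊆ K := by
  obtain ⟨K, hK, hKs⟩ := mem_cocompact.1 (h.eventually_lt x (one_div_pos.2 hr))
  refine ⟨K ∪ {x}, hK.union isCompact_singleton, ?_⟩
  rintro y (⟨-, hy⟩ | hy)
  · by_contra hyK
    exact absurd (hKs fun hy' => hyK (Or.inl hy')) (not_lt.2 hy.le)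
  · exact Or.inr hy

theorem eventually_LBall_subset_ball (h : IsDecayingKernel Γ) (x : EuclideanSpace ℝ (Fin n))
    {δ : ℝ} (hδ : 0 < δ) : ∀ᶠ r in 𝓝[>] (0 : ℝ), LBall Γ x r ⊆ ball x δ := by
  obtain ⟨K, hK, hKs⟩ := mem_cocompact.1 (h.eventually_lt x one_pos)
  have hc : ContinuousOn (Γ x) (K \ ball x δ) :=
    (h.continuousOn_right x).mono fun z hz => by rintro rfl; exact hz.2 (mem_ball_self hδ)
  obtain ⟨B, hB⟩ := (hK.diff isOpen_ball).exists_bound_of_continuousOn hc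
  have hlim : Tendsto (fun r : ℝ => 1 / r) (𝓝[>] 0) atTop := by
    simpa only [one_div] using tendsto_inv_nhdsGT_zero (𝕜 := ℝ)
  filter_upwards [hlim.eventually_gt_atTop (max B 1)] with r hr
  rintro y (⟨-, hy⟩ | rfl)
  · by_contra hyb
    by_cases hyK : y ∈ K
    · have := (le_abs_self _).trans (hB y ⟨hyK, hyb⟩)
      exact absurd (hr.trans hy) (not_lt.2 (this.trans (le_max_left _ _)))
    · have : Γ x y < 1 := hKs hyK
      exact absurd (hr.trans hy) (not_lt.2 (this.le.trans (le_max_right _ _)))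
  · exact mem_ball_self hδ

theorem exists_LBall_superset (h : IsDecayingKernel Γ) (x : EuclideanSpace ℝ (Fin n))
    {C : Set (EuclideanSpace ℝ (Fin n))} (hC : IsCompact C) : ∃ s, 0 < s ∧ C ⊆ LBall Γ x s := by
  obtain ⟨V, hV, hVo, hxV⟩ := _root_.eventually_nhds_iff.1
    (eventually_nhdsWithin_iff.1 ((h.blowup_right x).eventually_gt_atTop 1))
  have hc : ContinuousOn (fun y => (Γ x y)⁻¹) (C \ V) :=
    ((h.continuousOn_right x).mono fun z hz => by rintro rfl; exact hz.2 hxV).inv₀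
      fun z hz => (h.pos x z (by rintro rfl; exact hz.2 hxV)).ne'
  obtain ⟨B, hB⟩ := (hC.diff hVo).exists_bound_of_continuousOn hc
  have hs : 0 < max B 0 + 1 := by positivity
  refine ⟨max B 0 + 1, hs, fun y hy => ?_⟩
  by_cases hyx : y = x
  · exact Or.inr hyx
  refine Or.inl ⟨hyx, ?_⟩
  have hp := h.pos x y (Ne.symm hyx)
  rw [one_div_lt hs hp, one_div]
  by_cases hyV : y ∈ V
  · have h1 : (Γ x y)⁻¹ < 1 := inv_lt_one_of_one_lt₀ (hV y hyV hyx)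
    linarith [le_max_right B 0]
  · have h1 := (le_abs_self _).trans (hB y ⟨hy, hyV⟩)
    linarith [le_max_left B 0]

theorem measurableSet_LBall_prod (h : IsDecayingKernel Γ) (x : EuclideanSpace ℝ (Fin n)) :
    MeasurableSet {p : ℝ × EuclideanSpace ℝ (Fin n) | p.2 ∈ LBall Γ x p.1} := by
  have hm := h.measurable_right x
  have h1 : MeasurableSet {p : ℝ × EuclideanSpace ℝ (Fin n) | p.2 = x} :=
    measurable_snd (measurableSet_singleton x)
  have h2 : MeasurableSet {p : ℝ × EuclideanSpace ℝ (Fin n) | 1 / p.1 < Γ x p.2} :=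
    measurableSet_lt (measurable_fst.const_div 1) (hm.comp measurable_snd)
  exact (h1.compl.inter h2).union h1

theorem measurableSet_LBall (h : IsDecayingKernel Γ) (x : EuclideanSpace ℝ (Fin n)) (r : ℝ) :
    MeasurableSet (LBall Γ x r) :=
  (measurable_prodMk_left : Measurable (Prod.mk r)) (h.measurableSet_LBall_prod x)

theorem LBall_mono {x : EuclideanSpace ℝ (Fin n)} {ρ r : ℝ} (hρ : 0 < ρ) (hr : ρ ≤ r) :
    LBall Γ x ρ ⊆ LBall Γ x r :=
  Set.union_subset_union_left _ fun _ hy => ⟨hy.1, (one_div_le_one_div_of_le hρ hr).trans_lt hy.2⟩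

theorem integrableOn_LBall (h : IsDecayingKernel Γ) {w : EuclideanSpace ℝ (Fin n) → ℝ}
    (hw : Continuous w) (x : EuclideanSpace ℝ (Fin n)) {ρ : ℝ} (hρ : 0 < ρ) :
    IntegrableOn (fun y => (Γ x y - 1 / ρ) * w y) (LBall Γ x ρ) := by
  obtain ⟨K, hK, hsub⟩ := h.exists_isCompact_superset_LBall x hρ
  have h1 : IntegrableOn (fun y => Γ x y - 1 / ρ) K :=
    ((h.locallyIntegrable x).integrableOn_isCompact hK).sub
      (integrableOn_const hK.measure_ne_top)
  exact (h1.mul_continuousOn hw.continuousOn hK).mono_set hsub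

theorem stronglyMeasurable_integral_LBall (h : IsDecayingKernel Γ)
    {w : EuclideanSpace ℝ (Fin n) → ℝ} (hw : Continuous w) (x : EuclideanSpace ℝ (Fin n)) :
    StronglyMeasurable fun ρ : ℝ => ∫ y in LBall Γ x ρ, (Γ x y - 1 / ρ) * w y := by
  have hF : Measurable fun p : ℝ × EuclideanSpace ℝ (Fin n) => (Γ x p.2 - 1 / p.1) * w p.2 :=
    (((h.measurable_right x).comp measurable_snd).sub (measurable_fst.const_div 1)).mul
      (hw.measurable.comp measurable_snd)
  have := (hF.indicator (h.measurableSet_LBall_prod x)).stronglyMeasurable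
  have h2 := StronglyMeasurable.integral_prod_right
    (ν := (volume : Measure (EuclideanSpace ℝ (Fin n))))
    (f := fun ρ y => Set.indicator {p : ℝ × EuclideanSpace ℝ (Fin n) | p.2 ∈ LBall Γ x p.1}
      (fun p => (Γ x p.2 - 1 / p.1) * w p.2) (ρ, y)) this
  convert h2 using 2 with ρ
  rw [← integral_indicator (h.measurableSet_LBall x ρ)]
  rfl

theorem norm_integral_LBall_le [NeZero n] (h : IsDecayingKernel Γ)
    {w : EuclideanSpace ℝ (Fin n) → ℝ} (x : EuclideanSpace ℝ (Fin n)) {ρ ε : ℝ}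
    (hρ : 0 < ρ) (hwε : ∀ y ∈ LBall Γ x ρ, |w y| ≤ ε) :
    ‖∫ y in LBall Γ x ρ, (Γ x y - 1 / ρ) * w y‖ ≤
      ε * ∫ y in LBall Γ x ρ, (Γ x y - 1 / ρ) * 1 := by
  rw [← integral_const_mul]
  refine norm_integral_le_of_norm_le
    ((h.integrableOn_LBall continuous_const x hρ).const_mul ε) ?_
  rw [ae_restrict_iff' (h.measurableSet_LBall x ρ)]
  filter_upwards [compl_mem_ae_iff.2 (measure_singleton x)] with y hyx hy
  have hy' : 1 / ρ < Γ x y := by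
    rcases hy with hy | hy
    · exact hy.2
    · exact absurd hy hyx
  rw [norm_mul, Real.norm_eq_abs, abs_of_pos (sub_pos.2 hy'), mul_one, mul_comm]
  exact mul_le_mul_of_nonneg_right (hwε y hy) (sub_pos.2 hy').le

theorem intervalIntegrable_one {α : ℝ} {x : EuclideanSpace ℝ (Fin n)} {r : ℝ}
    (hQ : 0 < Qr Γ α x r) :
    IntervalIntegrable (fun ρ => ρ ^ α * ∫ y in LBall Γ x ρ, (Γ x y - 1 / ρ) * 1) volume 0 r := by
  by_contra hni
  rw [Qr, Nr, intervalIntegral.integral_undef hni, mul_zero] at hQ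
  exact lt_irrefl _ hQ

theorem intervalIntegrable_mul [NeZero n] (h : IsDecayingKernel Γ) {α : ℝ}
    {w : EuclideanSpace ℝ (Fin n) → ℝ} (hw : Continuous w) {x : EuclideanSpace ℝ (Fin n)} {r : ℝ}
    (hr : 0 < r) (hQ : 0 < Qr Γ α x r) :
    IntervalIntegrable (fun ρ => ρ ^ α * ∫ y in LBall Γ x ρ, (Γ x y - 1 / ρ) * w y)
      volume 0 r := by
  obtain ⟨K, hK, hsub⟩ := h.exists_isCompact_superset_LBall x hr
  obtain ⟨B, hB⟩ := hK.exists_bound_of_continuousOn hw.continuousOn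
  refine ((intervalIntegrable_one hQ).const_mul B).mono_fun ?_ ?_
  · have : Measurable fun ρ : ℝ => ρ ^ α := by fun_prop
    exact (this.stronglyMeasurable.mul
      (h.stronglyMeasurable_integral_LBall hw x)).aestronglyMeasurable
  · rw [Filter.EventuallyLE, ae_restrict_iff' measurableSet_uIoc]
    refine Eventually.of_forall fun ρ hρ => ?_
    rw [Set.uIoc_of_le hr.le] at hρ
    have h1 := h.norm_integral_LBall_le x hρ.1
      fun y hy => hB y (hsub (LBall_mono hρ.1 hρ.2 hy))
    rw [norm_mul]
    refine (mul_le_mul_of_nonneg_left h1 (norm_nonneg _)).trans (le_trans (le_of_eq ?_)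
      (le_abs_self _))
    rw [Real.norm_eq_abs, abs_of_nonneg (Real.rpow_nonneg hρ.1.le α)]
    ring

/-- The solid averages `N_r` are bounded by `Q_r` times the oscillation of the density. -/
theorem abs_Nr_sub_le [NeZero n] (h : IsDecayingKernel Γ) {α : ℝ} (hα : -1 < α)
    {w₁ w₂ : EuclideanSpace ℝ (Fin n) → ℝ} (hw₁ : Continuous w₁) (hw₂ : Continuous w₂)
    {x : EuclideanSpace ℝ (Fin n)} {r ε : ℝ} (hr : 0 < r) (hQ : 0 < Qr Γ α x r)
    (hε : ∀ y ∈ LBall Γ x r, |w₁ y - w₂ y| ≤ ε) :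
    |Nr Γ α w₁ x r - Nr Γ α w₂ x r| ≤ ε * Qr Γ α x r := by
  have hc : 0 < (α + 1) / r ^ (α + 1) :=
    div_pos (by linarith) (Real.rpow_pos_of_pos hr _)
  rw [Qr, Nr, Nr, Nr, ← mul_sub, ← intervalIntegral.integral_sub
    (h.intervalIntegrable_mul hw₁ hr hQ) (h.intervalIntegrable_mul hw₂ hr hQ), abs_mul,
    abs_of_pos hc, mul_left_comm]
  refine mul_le_mul_of_nonneg_left ?_ hc.le
  rw [← intervalIntegral.integral_const_mul, ← Real.norm_eq_abs]
  refine intervalIntegral.norm_integral_le_of_norm_le hr.le (Eventually.of_forall fun ρ hρ => ?_)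
    ((intervalIntegrable_one hQ).const_mul ε)
  have h1 := h.norm_integral_LBall_le (w := fun y => w₁ y - w₂ y) x hρ.1
    fun y hy => hε y (LBall_mono hρ.1 hρ.2 hy)
  rw [← mul_sub, ← integral_sub (h.integrableOn_LBall hw₁ x hρ.1)
    (h.integrableOn_LBall hw₂ x hρ.1), norm_mul, Real.norm_eq_abs,
    abs_of_nonneg (Real.rpow_nonneg hρ.1.le α), mul_left_comm]
  refine mul_le_mul_of_nonneg_left ?_ (Real.rpow_nonneg hρ.1.le α)
  simpa only [mul_sub] using h1

theorem Nr_const (α c : ℝ) (x : EuclideanSpace ℝ (Fin n)) (r : ℝ) :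
    Nr Γ α (fun _ => c) x r = c * Qr Γ α x r := by
  simp only [Qr, Nr, integral_mul_const, mul_one]
  simp only [← mul_assoc, intervalIntegral.integral_mul_const]
  ring

theorem integrable_mul (h : IsDecayingKernel Γ) {g : EuclideanSpace ℝ (Fin n) → ℝ}
    (hg : Continuous g) (hgs : HasCompactSupport g) (x : EuclideanSpace ℝ (Fin n)) :
    Integrable fun y => Γ x y * g y :=
  (h.locallyIntegrable x).integrable_smul_right_of_hasCompactSupport hg hgs

theorem abs_potential_sub_le [NeZero n] (h : IsDecayingKernel Γ)
    {f g : EuclideanSpace ℝ (Fin n) → ℝ}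
    (hf : Continuous f) (hfs : HasCompactSupport f) (hg : Continuous g) (hgs : HasCompactSupport g)
    {K : Set (EuclideanSpace ℝ (Fin n))} (hK : IsCompact K) (hfK : ∀ y ∉ K, f y = 0)
    (hgK : ∀ y ∉ K, g y = 0) {ε : ℝ} (hε : ∀ y, |f y - g y| ≤ ε) (x : EuclideanSpace ℝ (Fin n)) :
    |potential Γ f x - potential Γ g x| ≤ ε * ∫ y in K, Γ x y := by
  rw [potential, potential, ← integral_sub (h.integrable_mul hf hfs x) (h.integrable_mul hg hgs x),
    ← setIntegral_eq_integral_of_forall_compl_eq_zero (s := K)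
      (fun y hy => by simp [hfK y hy, hgK y hy]), ← integral_const_mul, ← Real.norm_eq_abs]
  refine norm_integral_le_of_norm_le
    (((h.locallyIntegrable x).integrableOn_isCompact hK).const_mul ε) ?_
  filter_upwards [ae_restrict_of_ae (compl_mem_ae_iff.2 (measure_singleton x))] with y hyx
  have hp := h.pos x y (Ne.symm hyx)
  rw [← mul_sub, norm_mul, Real.norm_eq_abs, abs_of_pos hp, mul_comm]
  exact mul_le_mul_of_nonneg_right (hε y) hp.le

theorem tendsto_potential_cocompact [NeZero n] (h : IsDecayingKernel Γ)
    {f : EuclideanSpace ℝ (Fin n) → ℝ} (hf : Continuous f) (hfs : HasCompactSupport f) :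
    Tendsto (potential Γ f) (cocompact _) (𝓝 0) := by
  obtain ⟨B, hB⟩ := hfs.exists_bound_of_continuous hf
  have hB0 : 0 ≤ B := (norm_nonneg _).trans (hB 0)
  set m := volume.real (tsupport f) with hm
  have hm0 : 0 ≤ m := measureReal_nonneg
  rw [Metric.tendsto_nhds]
  intro ε hε
  have hδ : 0 < ε / (B * m + 1) := by positivity
  filter_upwards [h.eventually_lt_of_isCompact hfs.isCompact hδ,
    hfs.isCompact.compl_mem_cocompact] with x hx hxK
  have h1 := h.abs_potential_sub_le hf hfs (g := fun _ => 0) continuous_const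
    HasCompactSupport.zero hfs.isCompact (fun y hy => image_eq_zero_of_notMem_tsupport hy)
    (fun _ _ => rfl) (ε := B) (by simpa using hB) x
  have h2 : ‖∫ y in tsupport f, Γ x y‖ ≤ ε / (B * m + 1) * m := by
    refine norm_setIntegral_le_of_norm_le_const hfs.isCompact.measure_lt_top fun y hy => ?_
    rw [Real.norm_eq_abs, abs_of_pos (h.pos x y (by rintro rfl; exact hxK hy))]
    exact (hx y hy).le
  have h3 : potential Γ (fun _ => 0) x = 0 := by simp [potential]
  rw [h3] at h1
  rw [dist_eq_norm, Real.norm_eq_abs]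
  calc |potential Γ f x - 0| ≤ B * (ε / (B * m + 1) * m) :=
        h1.trans (mul_le_mul_of_nonneg_left ((le_abs_self _).trans h2) hB0)
    _ = ε * (B * m) / (B * m + 1) := by ring
    _ < ε := by
        rw [div_lt_iff₀ (by positivity)]
        nlinarith [mul_nonneg hB0 hm0]

end IsDecayingKernel

/-- A compact set admits a smooth compactly supported cutoff equal to `1` near each point. -/
theorem exists_contDiff_cutoff {n : ℕ} {K : Set (EuclideanSpace ℝ (Fin n))} (hK : IsCompact K) :
    ∃ χ : EuclideanSpace ℝ (Fin n) → ℝ, ContDiff ℝ (⊤ : ℕ∞) χ ∧ HasCompactSupport χ ∧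
      (∀ y, |χ y| ≤ 1) ∧ ∀ y ∈ K, χ =ᶠ[𝓝 y] fun _ => 1 := by
  obtain ⟨R, hR, hKR⟩ := hK.isBounded.subset_ball_lt 0 (0 : EuclideanSpace ℝ (Fin n))
  let χ : ContDiffBump (0 : EuclideanSpace ℝ (Fin n)) := ⟨R, R + 1, hR, by linarith⟩
  refine ⟨χ, χ.contDiff, χ.hasCompactSupport, fun y => ?_, fun y hy => ?_⟩
  · rw [abs_of_nonneg χ.nonneg]
    exact χ.le_one
  · filter_upwards [isOpen_ball.mem_nhds (hKR hy)] with z hz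
    exact χ.one_of_mem_closedBall (ball_subset_closedBall hz)

/-- A compactly supported continuous function is a uniform limit of smooth functions supported in
a common compact set. -/
theorem exists_isCompact_forall_exists_contDiff_approx {n : ℕ}
    {f : EuclideanSpace ℝ (Fin n) → ℝ} (hf : Continuous f) (hfs : HasCompactSupport f) :
    ∃ K : Set (EuclideanSpace ℝ (Fin n)), IsCompact K ∧ (∀ y ∉ K, f y = 0) ∧
      ∀ ε > 0, ∃ g : EuclideanSpace ℝ (Fin n) → ℝ, ContDiff ℝ (⊤ : ℕ∞) g ∧ HasCompactSupport g ∧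
        (∀ y ∉ K, g y = 0) ∧ ∀ y, |f y - g y| ≤ ε := by
  obtain ⟨χ, hχ, hχs, hχ1, hχK⟩ := exists_contDiff_cutoff hfs.isCompact
  have hfχ : ∀ y, f y = χ y * f y := fun y => by
    by_cases hy : y ∈ tsupport f
    · rw [(hχK y hy).self_of_nhds, one_mul]
    · rw [image_eq_zero_of_notMem_tsupport hy, mul_zero]
  refine ⟨tsupport χ, hχs.isCompact, fun y hy => ?_, fun ε hε => ?_⟩
  · rw [hfχ, image_eq_zero_of_notMem_tsupport hy, zero_mul]
  · obtain ⟨g, hg, hgε⟩ := (hfs.uniformContinuous_of_continuous hf).exists_contDiff_dist_le hε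
    refine ⟨fun y => χ y * g y, hχ.mul hg, hχs.mul_right, fun y hy => ?_, fun y => ?_⟩
    · simp only [image_eq_zero_of_notMem_tsupport hy, zero_mul]
    · rw [hfχ, ← mul_sub, abs_mul]
      have h1 := (hgε y).le
      rw [dist_comm, Real.dist_eq] at h1
      exact (mul_le_mul (hχ1 y) h1 (abs_nonneg _) zero_le_one).trans (one_mul ε).le

namespace IsDecayingKernel

variable {n : ℕ} {Γ : EuclideanSpace ℝ (Fin n) → EuclideanSpace ℝ (Fin n) → ℝ}

theorem continuous_potential [NeZero n] (h : IsDecayingKernel Γ)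
    (hpot : ∀ g : EuclideanSpace ℝ (Fin n) → ℝ, ContDiff ℝ (⊤ : ℕ∞) g → HasCompactSupport g →
      Continuous (potential Γ g))
    (hsup : ∀ G K : Set (EuclideanSpace ℝ (Fin n)), IsCompact G → IsCompact K →
      ∃ C : ℝ, ∀ x ∈ G, (∫ y in K, Γ x y) ≤ C)
    {f : EuclideanSpace ℝ (Fin n) → ℝ} (hf : Continuous f) (hfs : HasCompactSupport f) :
    Continuous (potential Γ f) := by
  obtain ⟨K, hK, hfK, happ⟩ := exists_isCompact_forall_exists_contDiff_approx hf hfs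
  refine continuous_of_locally_uniform_approx_of_continuousAt fun x V hV => ?_
  obtain ⟨ε, hε, hεV⟩ := Metric.mem_uniformity_dist.1 hV
  obtain ⟨C, hC⟩ := hsup (closedBall x 1) K (isCompact_closedBall x 1) hK
  obtain ⟨g, hg, hgs, hgK, hfg⟩ := happ (ε / (|C| + 1)) (by positivity)
  refine ⟨closedBall x 1, closedBall_mem_nhds x one_pos, potential Γ g,
    (hpot g hg hgs).continuousAt, fun y hy => hεV ?_⟩
  rw [Real.dist_eq]
  calc |potential Γ f y - potential Γ g y|
      ≤ ε / (|C| + 1) * ∫ z in K, Γ y z :=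
        h.abs_potential_sub_le hf hfs hg.continuous hgs hK hfK hgK hfg y
    _ ≤ ε / (|C| + 1) * |C| :=
        mul_le_mul_of_nonneg_left ((hC y hy).trans (le_abs_self C)) (by positivity)
    _ < ε := by
        rw [div_mul_eq_mul_div, div_lt_iff₀ (by positivity)]
        linarith

end IsDecayingKernel

theorem Kker_nonneg {n : ℕ} {Γ : EuclideanSpace ℝ (Fin n) → EuclideanSpace ℝ (Fin n) → ℝ}
    {A : EuclideanSpace ℝ (Fin n) → Matrix (Fin n) (Fin n) ℝ} {α : ℝ}
    {x y : EuclideanSpace ℝ (Fin n)} (hA : (A y).PosSemidef) (hΓ : 0 ≤ Γ x y) :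
    0 ≤ Kker Γ A α x y := by
  refine div_nonneg ?_ (Real.rpow_nonneg hΓ _)
  have := hA.dotProduct_mulVec_nonneg fun i => pd i (fun z => Γ x z) y
  convert this using 1
  simp only [dotProduct, Matrix.mulVec, Finset.mul_sum, Pi.star_apply, star_trivial]
  exact Finset.sum_congr rfl fun i _ => Finset.sum_congr rfl fun j _ => by ring

theorem Lop_const {n : ℕ} (A : EuclideanSpace ℝ (Fin n) → Matrix (Fin n) (Fin n) ℝ) (c : ℝ) :
    Lop A (fun _ => c) = fun _ => 0 := by
  ext x
  simp [Lop, pd]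

theorem Lop_congr_of_eventuallyEq {n : ℕ}
    {A : EuclideanSpace ℝ (Fin n) → Matrix (Fin n) (Fin n) ℝ}
    {u v : EuclideanSpace ℝ (Fin n) → ℝ} {x : EuclideanSpace ℝ (Fin n)} (huv : u =ᶠ[𝓝 x] v) :
    Lop A u x = Lop A v x := by
  refine Finset.sum_congr rfl fun i _ => Finset.sum_congr rfl fun j _ => ?_
  have : (fun z => A z i j * pd j u z) =ᶠ[𝓝 x] fun z => A z i j * pd j v z :=
    (huv.fderiv (𝕜 := ℝ)).mono fun z hz => by simp only [pd, hz]
  rw [pd, pd, this.fderiv_eq]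

theorem continuous_Lop {n : ℕ} {A : EuclideanSpace ℝ (Fin n) → Matrix (Fin n) (Fin n) ℝ}
    (hA : ∀ i j, ContDiff ℝ (⊤ : ℕ∞) fun x => A x i j) {φ : EuclideanSpace ℝ (Fin n) → ℝ}
    (hφ : ContDiff ℝ (⊤ : ℕ∞) φ) : Continuous (Lop A φ) := by
  refine continuous_finsetSum _ fun i _ => continuous_finsetSum _ fun j _ => ?_
  have h1 : ContDiff ℝ (⊤ : ℕ∞) fun z => pd j φ z :=
    (hφ.fderiv_right (by simp)).clm_apply contDiff_const
  exact (((hA i j).mul h1).continuous_fderiv (by simp)).clm_apply continuous_const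

theorem hasCompactSupport_Lop {n : ℕ} (A : EuclideanSpace ℝ (Fin n) → Matrix (Fin n) (Fin n) ℝ)
    {φ : EuclideanSpace ℝ (Fin n) → ℝ} (hφ : HasCompactSupport φ) :
    HasCompactSupport (Lop A φ) := by
  refine HasCompactSupport.intro hφ.isCompact fun x hx => ?_
  rw [Lop_congr_of_eventuallyEq (notMem_tsupport_iff_eventuallyEq.1 hx)]
  exact congrFun (Lop_const A 0) x

section MeanValue

variable {n : ℕ} {Γ : EuclideanSpace ℝ (Fin n) → EuclideanSpace ℝ (Fin n) → ℝ}
  {A : EuclideanSpace ℝ (Fin n) → Matrix (Fin n) (Fin n) ℝ} {α : ℝ}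
  {x : EuclideanSpace ℝ (Fin n)} {r : ℝ}

theorem integrableOn_Kker (hM : Mr Γ A α (fun _ => 1) x r = 1) :
    IntegrableOn (Kker Γ A α x) (LBall Γ x r) := by
  by_contra hni
  have h0 : ∫ y in LBall Γ x r, 1 * Kker Γ A α x y = 0 := by
    simp only [one_mul]
    exact integral_undef hni
  rw [Mr, h0, mul_zero] at hM
  exact zero_ne_one hM

theorem integral_Kker (hα : -1 < α) (hr : 0 < r) (hM : Mr Γ A α (fun _ => 1) x r = 1) :
    ∫ y in LBall Γ x r, Kker Γ A α x y = r ^ (α + 1) / (α + 1) := by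
  have h1 : 0 < α + 1 := by linarith
  have h2 := Real.rpow_pos_of_pos hr (α + 1)
  rw [Mr] at hM
  simp only [one_mul] at hM
  field_simp at hM ⊢
  linarith

theorem ae_Kker_nonneg [NeZero n] (h : IsDecayingKernel Γ) (hA : ∀ y, (A y).PosSemidef)
    (x : EuclideanSpace ℝ (Fin n)) : ∀ᵐ y, 0 ≤ Kker Γ A α x y := by
  filter_upwards [compl_mem_ae_iff.2 (measure_singleton x)] with y hyx
  exact Kker_nonneg (hA y) (h.pos x y (Ne.symm hyx)).le

theorem integrableOn_mul_Kker (h : IsDecayingKernel Γ) (hr : 0 < r)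
    (hM : Mr Γ A α (fun _ => 1) x r = 1) {w : EuclideanSpace ℝ (Fin n) → ℝ} (hw : Continuous w) :
    IntegrableOn (fun y => w y * Kker Γ A α x y) (LBall Γ x r) := by
  obtain ⟨K, hK, hsub⟩ := h.exists_isCompact_superset_LBall x hr
  obtain ⟨B, hB⟩ := hK.exists_bound_of_continuousOn hw.continuousOn
  exact (integrableOn_Kker hM).bdd_mul hw.aestronglyMeasurable
    ((ae_restrict_iff' (h.measurableSet_LBall x r)).2
      (Eventually.of_forall fun y hy => hB y (hsub hy)))

theorem Mr_sub (h : IsDecayingKernel Γ) (hr : 0 < r)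
    (hM : Mr Γ A α (fun _ => 1) x r = 1) {w₁ w₂ : EuclideanSpace ℝ (Fin n) → ℝ}
    (hw₁ : Continuous w₁) (hw₂ : Continuous w₂) :
    Mr Γ A α (fun y => w₁ y - w₂ y) x r = Mr Γ A α w₁ x r - Mr Γ A α w₂ x r := by
  simp only [Mr, sub_mul]
  rw [integral_sub (integrableOn_mul_Kker h hr hM hw₁) (integrableOn_mul_Kker h hr hM hw₂), mul_sub]

theorem abs_Mr_le [NeZero n] (h : IsDecayingKernel Γ) (hA : ∀ y, (A y).PosSemidef) (hα : -1 < α)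
    (hr : 0 < r) (hM : Mr Γ A α (fun _ => 1) x r = 1) {w : EuclideanSpace ℝ (Fin n) → ℝ} {ε : ℝ}
    (hε : ∀ y ∈ LBall Γ x r, |w y| ≤ ε) : |Mr Γ A α w x r| ≤ ε := by
  have h1 : 0 < α + 1 := by linarith
  have h2 := Real.rpow_pos_of_pos hr (α + 1)
  have h3 : ‖∫ y in LBall Γ x r, w y * Kker Γ A α x y‖ ≤
      ∫ y in LBall Γ x r, ε * Kker Γ A α x y := by
    refine norm_integral_le_of_norm_le ((integrableOn_Kker hM).const_mul ε) ?_
    rw [ae_restrict_iff' (h.measurableSet_LBall x r)]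
    filter_upwards [ae_Kker_nonneg (α := α) h hA x] with y hy hyr
    rw [norm_mul, Real.norm_eq_abs, Real.norm_eq_abs, abs_of_nonneg hy]
    exact mul_le_mul_of_nonneg_right (hε y hyr) hy
  rw [integral_const_mul, integral_Kker hα hr hM] at h3
  rw [Mr, abs_mul, abs_of_pos (div_pos h1 h2), ← Real.norm_eq_abs]
  refine (mul_le_mul_of_nonneg_left h3 (div_pos h1 h2).le).trans (le_of_eq ?_)
  field_simp

/-- A Liouville theorem: a continuous function with the mean value property on all `L`-balls which
vanishes at infinity is identically zero. -/
theorem eq_zero_of_Mr_eq_self [NeZero n] (h : IsDecayingKernel Γ) (hA : ∀ y, (A y).PosSemidef)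
    (hα : -1 < α) (hM : ∀ x r, 0 < r → Mr Γ A α (fun _ => 1) x r = 1)
    {v : EuclideanSpace ℝ (Fin n) → ℝ} (hv : Continuous v)
    (hv0 : Tendsto v (cocompact _) (𝓝 0)) (hmean : ∀ x r, 0 < r → Mr Γ A α v x r = v x)
    (x : EuclideanSpace ℝ (Fin n)) : v x = 0 := by
  have h1 : 0 < α + 1 := by linarith
  suffices ∀ ε > 0, |v x| ≤ ε from
    abs_eq_zero.1 (le_antisymm (le_of_forall_gt_imp_ge_of_dense fun ε hε => this ε hε)
      (abs_nonneg _))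
  intro ε hε
  obtain ⟨C, hC, hCε⟩ := mem_cocompact.1 (Metric.tendsto_nhds.1 hv0 ε hε)
  obtain ⟨s, hs, hCs⟩ := h.exists_LBall_superset x hC
  obtain ⟨B, hB⟩ := hC.exists_bound_of_continuousOn hv.continuousOn
  have hbound : ∀ y, |v y| ≤ ε + (LBall Γ x s).indicator (fun _ => |B|) y := fun y => by
    by_cases hy : y ∈ C
    · rw [Set.indicator_of_mem (hCs hy)]
      linarith [hB y hy, le_abs_self B, Real.norm_eq_abs (v y)]
    · have h2 : dist (v y) 0 < ε := hCε hy
      rw [dist_zero_right, Real.norm_eq_abs] at h2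
      linarith [Set.indicator_nonneg (s := LBall Γ x s) (fun _ _ => abs_nonneg B) y]
  have hkey : ∀ r, s ≤ r → |v x| ≤ ε + |B| * s ^ (α + 1) * r ^ (-(α + 1)) := fun r hsr => by
    have hr : 0 < r := hs.trans_le hsr
    have h2 := Real.rpow_pos_of_pos hr (α + 1)
    have hKr := integrableOn_Kker (hM x r hr)
    have hKs := ((integrableOn_Kker (hM x s hs)).integrable_indicator
      (h.measurableSet_LBall x s)).integrableOn (s := LBall Γ x r)
    have h3 : ‖∫ y in LBall Γ x r, v y * Kker Γ A α x y‖ ≤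
        ∫ y in LBall Γ x r, (ε * Kker Γ A α x y +
          |B| * (LBall Γ x s).indicator (Kker Γ A α x) y) := by
      refine norm_integral_le_of_norm_le ((hKr.const_mul ε).add (hKs.const_mul |B|)) ?_
      filter_upwards [ae_restrict_of_ae (ae_Kker_nonneg (α := α) h hA x)] with y hy
      rw [norm_mul, Real.norm_eq_abs, Real.norm_eq_abs, abs_of_nonneg hy]
      refine (mul_le_mul_of_nonneg_right (hbound y) hy).trans (le_of_eq ?_)
      by_cases hys : y ∈ LBall Γ x s <;> simp [hys, add_mul]
    rw [integral_add (hKr.const_mul ε) (hKs.const_mul |B|), integral_const_mul,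
      integral_const_mul, setIntegral_indicator (h.measurableSet_LBall x s),
      Set.inter_eq_self_of_subset_right (IsDecayingKernel.LBall_mono hs hsr),
      integral_Kker hα hr (hM x r hr), integral_Kker hα hs (hM x s hs)] at h3
    rw [← hmean x r hr, Mr, abs_mul, abs_of_pos (div_pos h1 h2), ← Real.norm_eq_abs]
    refine (mul_le_mul_of_nonneg_left h3 (div_pos h1 h2).le).trans (le_of_eq ?_)
    rw [Real.rpow_neg hr.le]
    field_simp
  have hlim : Tendsto (fun r : ℝ => ε + |B| * s ^ (α + 1) * r ^ (-(α + 1))) atTop (𝓝 ε) := by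
    simpa using ((tendsto_rpow_neg_atTop h1).const_mul (|B| * s ^ (α + 1))).const_add ε
  exact ge_of_tendsto hlim (eventually_atTop.2 ⟨s, hkey⟩)

/-- The asymptotic behaviour of the mean value operator on a function whose mean value defect is
`N_r(-f)`. -/
theorem tendsto_div_Qr [NeZero n] (h : IsDecayingKernel Γ) (hα : -1 < α)
    (hQ : ∀ r, 0 < r → 0 < Qr Γ α x r) {U f : EuclideanSpace ℝ (Fin n) → ℝ} (hf : Continuous f)
    (hU : ∀ r, 0 < r → Mr Γ A α U x r - U x = Nr Γ α (fun y => -f y) x r) :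
    Tendsto (fun r : ℝ => (Mr Γ A α U x r - U x) / Qr Γ α x r) (𝓝[>] 0) (𝓝 (-f x)) := by
  rw [Metric.tendsto_nhds]
  intro ε hε
  obtain ⟨δ, hδ, hfδ⟩ := Metric.continuousAt_iff.1 (hf.continuousAt (x := x)) (ε / 2) (by positivity)
  filter_upwards [h.eventually_LBall_subset_ball x hδ, self_mem_nhdsWithin] with r hsub hr
  have hr : 0 < r := hr
  have hQr := hQ r hr
  have h1 := h.abs_Nr_sub_le hα hf.neg (continuous_const (y := -f x)) hr hQr (ε := ε / 2)
    fun y hy => by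
      have := (hfδ (hsub hy)).le
      rwa [dist_comm, Real.dist_eq, show f x - f y = -f y - -f x by ring] at this
  rw [IsDecayingKernel.Nr_const] at h1
  rw [hU r hr, Real.dist_eq, show Nr Γ α (fun y => -f y) x r / Qr Γ α x r - -f x =
    (Nr Γ α (fun y => -f y) x r - -f x * Qr Γ α x r) / Qr Γ α x r by field_simp, abs_div,
    abs_of_pos hQr, div_lt_iff₀ hQr]
  refine h1.trans_lt ?_
  nlinarith [mul_pos hε hQr]

/-- The mean value formula for potentials of compactly supported continuous densities. -/
theorem Mr_potential_sub [NeZero n] (h : IsDecayingKernel Γ) (hA : ∀ y, (A y).PosSemidef)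
    (hα : -1 < α) (hM : Mr Γ A α (fun _ => 1) x r = 1) (hr : 0 < r) (hQ : 0 < Qr Γ α x r)
    (hpot : ∀ g : EuclideanSpace ℝ (Fin n) → ℝ, ContDiff ℝ (⊤ : ℕ∞) g → HasCompactSupport g →
      Continuous (potential Γ g) ∧
        Mr Γ A α (potential Γ g) x r - potential Γ g x = Nr Γ α (fun y => -g y) x r)
    (hsup : ∀ G K : Set (EuclideanSpace ℝ (Fin n)), IsCompact G → IsCompact K →
      ∃ C : ℝ, ∀ x ∈ G, (∫ y in K, Γ x y) ≤ C)
    {f : EuclideanSpace ℝ (Fin n) → ℝ} (hf : Continuous f) (hfs : HasCompactSupport f) :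
    Mr Γ A α (potential Γ f) x r - potential Γ f x = Nr Γ α (fun y => -f y) x r := by
  have hcont := h.continuous_potential (fun g hg hgs => (hpot g hg hgs).1) hsup hf hfs
  obtain ⟨K, hK, hfK, happ⟩ := exists_isCompact_forall_exists_contDiff_approx hf hfs
  obtain ⟨G, hG, hsub⟩ := h.exists_isCompact_superset_LBall x hr
  have hxG : x ∈ G := hsub (Or.inr rfl)
  obtain ⟨C, hC⟩ := hsup G K hG hK
  have hbound : ∀ ε > 0, |Mr Γ A α (potential Γ f) x r - potential Γ f x -
      Nr Γ α (fun y => -f y) x r| ≤ (2 * C + Qr Γ α x r) * ε := fun ε hε => by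
    obtain ⟨g, hg, hgs, hgK, hfg⟩ := happ ε hε
    obtain ⟨hgc, hgm⟩ := hpot g hg hgs
    have hp : ∀ y ∈ G, |potential Γ f y - potential Γ g y| ≤ ε * C := fun y hy =>
      (h.abs_potential_sub_le hf hfs hg.continuous hgs hK hfK hgK hfg y).trans
        (mul_le_mul_of_nonneg_left (hC y hy) hε.le)
    have h1 := abs_Mr_le h hA hα hr hM fun y hy => hp y (hsub hy)
    rw [Mr_sub h hr hM hcont hgc] at h1
    have h2 := hp x hxG
    have h3 := h.abs_Nr_sub_le (w₁ := fun y => -f y) (w₂ := fun y => -g y) hα hf.neg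
      hg.continuous.neg hr hQ (ε := ε) fun y _ => by
      have := hfg y
      rwa [abs_sub_comm, show g y - f y = -f y - -g y by ring] at this
    rw [abs_le] at h1 h2 h3 ⊢
    constructor <;> linarith [h1.1, h1.2, h2.1, h2.2, h3.1, h3.2]
  have hlim : Tendsto (fun ε : ℝ => (2 * C + Qr Γ α x r) * ε) (𝓝[>] 0) (𝓝 0) := by
    have : Tendsto (fun ε : ℝ => (2 * C + Qr Γ α x r) * ε) (𝓝 0)
        (𝓝 ((2 * C + Qr Γ α x r) * 0)) := tendsto_id.const_mul _
    rw [mul_zero] at this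
    exact this.mono_left nhdsWithin_le_nhds
  exact sub_eq_zero.1 (abs_eq_zero.1 (le_antisymm
    (ge_of_tendsto hlim (eventually_nhdsWithin_of_forall hbound)) (abs_nonneg _)))

end MeanValue

namespace IsDecayingKernel

variable {n : ℕ} {Γ : EuclideanSpace ℝ (Fin n) → EuclideanSpace ℝ (Fin n) → ℝ}

/-- Fubini's theorem for the symmetric kernel `Γ`. -/
theorem integral_potential_mul [NeZero n] (h : IsDecayingKernel Γ)
    (hsup : ∀ G K : Set (EuclideanSpace ℝ (Fin n)), IsCompact G → IsCompact K →
      ∃ C : ℝ, ∀ x ∈ G, (∫ y in K, Γ x y) ≤ C)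
    {f g : EuclideanSpace ℝ (Fin n) → ℝ}
    (hf : Continuous f) (hfs : HasCompactSupport f)
    (hg : Continuous g) (hgs : HasCompactSupport g) :
    ∫ x, potential Γ f x * g x = ∫ y, f y * potential Γ g y := by
  let D : Set (EuclideanSpace ℝ (Fin n) × EuclideanSpace ℝ (Fin n)) := {p | p.1 ≠ p.2}
  have hD : IsOpen D := isOpen_ne_fun continuous_fst continuous_snd
  let Φ : EuclideanSpace ℝ (Fin n) × EuclideanSpace ℝ (Fin n) → ℝ :=
    D.indicator fun p => Γ p.1 p.2
  have hΦ : AEStronglyMeasurable Φ (volume.prod volume) :=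
    (aestronglyMeasurable_indicator_iff hD.measurableSet).2
      (h.continuousOn.aestronglyMeasurable hD.measurableSet)
  have hΦ1 : ∀ x, ∀ᵐ y, Φ (x, y) = Γ x y := fun x => by
    filter_upwards [compl_mem_ae_iff.2 (measure_singleton x)] with y hyx
    exact Set.indicator_of_mem (show (x, y) ∈ D from Ne.symm hyx) _
  have hΦ2 : ∀ y, ∀ᵐ x, Φ (x, y) = Γ y x := fun y => by
    filter_upwards [compl_mem_ae_iff.2 (measure_singleton y)] with x hxy
    rw [← h.symm x y hxy]
    exact Set.indicator_of_mem (show (x, y) ∈ D from hxy) _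
  have hfi := fun x => h.integrable_mul hf hfs x
  have hsec : ∀ x, (fun y => Φ (x, y) * f y * g x) =ᵐ[volume] fun y => Γ x y * f y * g x :=
    fun x => (hΦ1 x).mono fun y hy => by simp only [hy]
  have hmeas : AEStronglyMeasurable
      (fun p : EuclideanSpace ℝ (Fin n) × EuclideanSpace ℝ (Fin n) => Φ p * f p.2 * g p.1)
      (volume.prod volume) :=
    (hΦ.mul (hf.comp continuous_snd).aestronglyMeasurable).mul
      (hg.comp continuous_fst).aestronglyMeasurable
  obtain ⟨B, hB⟩ := hfs.exists_bound_of_continuous hf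
  obtain ⟨C, hC⟩ := hsup _ _ hgs.isCompact hfs.isCompact
  have hint : Integrable
      (fun p : EuclideanSpace ℝ (Fin n) × EuclideanSpace ℝ (Fin n) => Φ p * f p.2 * g p.1)
      (volume.prod volume) := by
    refine (integrable_prod_iff hmeas).2
      ⟨Eventually.of_forall fun x => ((hfi x).mul_const _).congr (hsec x).symm, ?_⟩
    refine ((hg.integrable_of_hasCompactSupport hgs).norm.const_mul (B * C)).mono'
      hmeas.norm.integral_prod_right' (Eventually.of_forall fun x => ?_)
    have habs : ∫ y, ‖Φ (x, y) * f y * g x‖ = potential Γ (fun y => |f y|) x * ‖g x‖ := by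
      rw [potential, ← integral_mul_const]
      refine integral_congr_ae ?_
      filter_upwards [hΦ1 x, compl_mem_ae_iff.2 (measure_singleton x)] with y hy hyx
      rw [hy, norm_mul, norm_mul, Real.norm_eq_abs, Real.norm_eq_abs,
        abs_of_pos (h.pos x y (Ne.symm hyx))]
    have hle := h.abs_potential_sub_le hf.abs hfs.norm (g := fun _ => 0) continuous_const
      HasCompactSupport.zero hfs.isCompact
      (fun y hy => by simp [image_eq_zero_of_notMem_tsupport hy])
      (fun _ _ => rfl) (ε := B) (by simpa using hB) x
    rw [show potential Γ (fun _ => 0) x = 0 by simp [potential], sub_zero] at hle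
    rw [habs, norm_mul, norm_norm, Real.norm_eq_abs]
    by_cases hx : x ∈ tsupport g
    · refine mul_le_mul_of_nonneg_right (hle.trans ?_) (norm_nonneg _)
      exact mul_le_mul_of_nonneg_left (hC x hx) ((norm_nonneg _).trans (hB 0))
    · simp [image_eq_zero_of_notMem_tsupport hx]
  calc ∫ x, potential Γ f x * g x = ∫ x, ∫ y, Φ (x, y) * f y * g x := by
        refine integral_congr_ae (Eventually.of_forall fun x => ?_)
        simp only [potential]
        rw [← integral_mul_const, integral_congr_ae (hsec x)]
    _ = ∫ y, ∫ x, Φ (x, y) * f y * g x := integral_integral_swap hint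
    _ = ∫ y, f y * potential Γ g y := by
        refine integral_congr_ae (Eventually.of_forall fun y => ?_)
        simp only [potential]
        rw [← integral_const_mul]
        refine integral_congr_ae ((hΦ2 y).mono fun x hx => ?_)
        simp only [hx]
        ring

end IsDecayingKernel

/-- under the hypotheses (a), (b), (c) of the Main Theorem together with
(d) (`Γ` is a fundamental solution of `L`) and (e) (characterization of asymptotic
`L`-harmonicity), for compactly supported continuous `f, u : ℝⁿ → ℝ`, `u` is an
asymptotic average solution of `L_a u = −f` if and only if `L u = −f` in the sense of
distributions. -/
theorem asymptotic_average_solution_iff_distributional {n : ℕ}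
    (A : EuclideanSpace ℝ (Fin n) → Matrix (Fin n) (Fin n) ℝ)
    (hAsymm : ∀ x, (A x).IsSymm)
    (hAsmooth : ∀ i j, ContDiff ℝ (⊤ : ℕ∞) fun x => A x i j)
    (hApsd : ∀ x, (A x).PosSemidef)
    (hAtrace : ∀ x, 0 < ∑ i : Fin n, A x i i)
    (Γ : EuclideanSpace ℝ (Fin n) → EuclideanSpace ℝ (Fin n) → ℝ)
    (hΓsmooth : ContDiffOn ℝ (⊤ : ℕ∞)
      (fun p : EuclideanSpace ℝ (Fin n) × EuclideanSpace ℝ (Fin n) => Γ p.1 p.2)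
      {p | p.1 ≠ p.2})
    (hsymm : ∀ x y, x ≠ y → Γ x y = Γ y x)
    (hpos : ∀ x y, x ≠ y → 0 < Γ x y)
    (hblow : ∀ y, Tendsto (fun x => Γ x y) (𝓝[≠] y) atTop)
    (hdecay : ∀ K : Set (EuclideanSpace ℝ (Fin n)), IsCompact K →
      Tendsto (fun x => ⨆ y : K, Γ x (y : EuclideanSpace ℝ (Fin n)))
        (Filter.cocompact _) (𝓝 0))
    (hloc : ∀ x, LocallyIntegrable (Γ x) volume)
    (α : ℝ) (hα : -1 < α)
    (hQ : ∀ (x : EuclideanSpace ℝ (Fin n)) (r : ℝ), 0 < r → 0 < Qr Γ α x r)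
    (hrep : ∀ u : EuclideanSpace ℝ (Fin n) → ℝ, ContDiff ℝ 2 u →
      ∀ (x : EuclideanSpace ℝ (Fin n)) (r : ℝ), 0 < r →
        u x = Mr Γ A α u x r - Nr Γ α (Lop A u) x r)
    (hpot : ∀ g : EuclideanSpace ℝ (Fin n) → ℝ, ContDiff ℝ (⊤ : ℕ∞) g → HasCompactSupport g →
      ContDiff ℝ (⊤ : ℕ∞) (potential Γ g) ∧ ∀ x, Lop A (potential Γ g) x = -g x)
    (hsup : ∀ G K : Set (EuclideanSpace ℝ (Fin n)), IsCompact G → IsCompact K →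
      ∃ C : ℝ, ∀ x ∈ G, (∫ y in K, Γ x y) ≤ C)
    (hfund : ∀ φ : EuclideanSpace ℝ (Fin n) → ℝ, ContDiff ℝ (⊤ : ℕ∞) φ → HasCompactSupport φ →
      ∀ x, (∫ y, Γ x y * Lop A φ y) = -φ x)
    (hharm : ∀ v : EuclideanSpace ℝ (Fin n) → ℝ, Continuous v →
      ((∀ x, Tendsto (fun r : ℝ => (Mr Γ A α v x r - v x) / Qr Γ α x r) (𝓝[>] 0) (𝓝 0))
        ↔ (ContDiff ℝ (⊤ : ℕ∞) v ∧ ∀ x, Lop A v x = 0)))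
    (f u : EuclideanSpace ℝ (Fin n) → ℝ)
    (hf : Continuous f) (hfs : HasCompactSupport f)
    (hu : Continuous u) (hus : HasCompactSupport u) :
    (∀ x, Tendsto (fun r : ℝ => (Mr Γ A α u x r - u x) / Qr Γ α x r) (𝓝[>] 0) (𝓝 (-f x)))
      ↔ (∀ φ : EuclideanSpace ℝ (Fin n) → ℝ, ContDiff ℝ (⊤ : ℕ∞) φ → HasCompactSupport φ →
          (∫ y, u y * Lop A φ y) = -∫ y, f y * φ y) := by
  have hn : n ≠ 0 := by
    rintro rfl
    simpa using hAtrace 0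
  have : NeZero n := ⟨hn⟩
  have h : IsDecayingKernel Γ := ⟨hΓsmooth.continuousOn, hsymm, hpos, hblow, hdecay, hloc⟩
  have hM : ∀ x r, 0 < r → Mr Γ A α (fun _ => 1) x r = 1 := fun x r hr => by
    have h1 := hrep (fun _ => 1) contDiff_const x r hr
    rw [Lop_const, IsDecayingKernel.Nr_const, zero_mul, sub_zero] at h1
    exact h1.symm
  have hpotM : ∀ x r, 0 < r → ∀ g : EuclideanSpace ℝ (Fin n) → ℝ, ContDiff ℝ (⊤ : ℕ∞) g →
      HasCompactSupport g → Continuous (potential Γ g) ∧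
        Mr Γ A α (potential Γ g) x r - potential Γ g x = Nr Γ α (fun y => -g y) x r :=
    fun x r hr g hg hgs => by
      obtain ⟨h1, h2⟩ := hpot g hg hgs
      have h3 := hrep _ (h1.of_le (WithTop.coe_le_coe.2 le_top)) x r hr
      rw [show Lop A (potential Γ g) = fun y => -g y from funext h2] at h3
      exact ⟨h1.continuous, by linarith⟩
  have hUc : Continuous (potential Γ f) :=
    h.continuous_potential (fun g hg hgs => (hpot g hg hgs).1.continuous) hsup hf hfs
  have hUlim : ∀ x, Tendsto (fun r : ℝ => (Mr Γ A α (potential Γ f) x r - potential Γ f x) /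
      Qr Γ α x r) (𝓝[>] 0) (𝓝 (-f x)) := fun x =>
    tendsto_div_Qr h hα (hQ x) hf fun r hr =>
      Mr_potential_sub h hApsd hα (hM x r hr) hr (hQ x r hr) (hpotM x r hr) hsup hf hfs
  suffices hmain : u = potential Γ f ↔ (∀ φ : EuclideanSpace ℝ (Fin n) → ℝ,
      ContDiff ℝ (⊤ : ℕ∞) φ → HasCompactSupport φ →
        (∫ y, u y * Lop A φ y) = -∫ y, f y * φ y) by
    rw [← hmain]
    constructor
    · intro hlim
      have hv : Continuous fun y => u y - potential Γ f y := hu.sub hUc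
      have hvlim : ∀ x, Tendsto (fun r : ℝ => (Mr Γ A α (fun y => u y - potential Γ f y) x r -
          (u x - potential Γ f x)) / Qr Γ α x r) (𝓝[>] 0) (𝓝 0) := fun x => by
        have h1 := (hlim x).sub (hUlim x)
        rw [sub_self] at h1
        refine h1.congr' (eventually_nhdsWithin_of_forall fun r hr => ?_)
        beta_reduce
        rw [Mr_sub h hr (hM x r hr) hu hUc]
        ring
      obtain ⟨hvs, hvL⟩ := (hharm _ hv).1 hvlim
      have hmean : ∀ x r, 0 < r → Mr Γ A α (fun y => u y - potential Γ f y) x r =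
          u x - potential Γ f x := fun x r hr => by
        have h1 := hrep _ (hvs.of_le (WithTop.coe_le_coe.2 le_top)) x r hr
        rw [funext hvL, IsDecayingKernel.Nr_const, zero_mul, sub_zero] at h1
        exact h1.symm
      have hv0 : Tendsto (fun y => u y - potential Γ f y) (cocompact _) (𝓝 0) := by
        have hu0 : Tendsto u (cocompact _) (𝓝 0) :=
          tendsto_const_nhds.congr' (mem_of_superset hus.isCompact.compl_mem_cocompact
            fun y hy => (image_eq_zero_of_notMem_tsupport hy).symm)
        simpa using hu0.sub (h.tendsto_potential_cocompact hf hfs)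
      exact funext fun x => sub_eq_zero.1 (eq_zero_of_Mr_eq_self h hApsd hα hM hv hv0 hmean x)
    · intro hue
      simpa only [hue] using hUlim
  constructor
  · intro hue φ hφ hφs
    rw [hue, h.integral_potential_mul hsup hf hfs (continuous_Lop hAsmooth hφ)
      (hasCompactSupport_Lop A hφs), ← integral_neg]
    refine integral_congr_ae (Eventually.of_forall fun y => ?_)
    simp only [potential]
    rw [hfund φ hφ hφs y, mul_neg]
  · intro hdist
    have hv : Continuous fun y => u y - potential Γ f y := hu.sub hUc
    have hzero : ∀ g : EuclideanSpace ℝ (Fin n) → ℝ, ContDiff ℝ (⊤ : ℕ∞) g →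
        HasCompactSupport g → ∫ y, g y • (u y - potential Γ f y) = 0 := fun g hg hgs => by
      obtain ⟨hp, hpL⟩ := hpot g hg hgs
      obtain ⟨χ, hχ, hχs, -, hχK⟩ := exists_contDiff_cutoff (hus.isCompact.union hfs.isCompact)
      have h1 := hdist (fun y => χ y * potential Γ g y) (hχ.mul hp) hχs.mul_right
      have h2 : ∀ y, u y * Lop A (fun z => χ z * potential Γ g z) y = -(g y * u y) := fun y => by
        by_cases hy : y ∈ tsupport u
        · rw [Lop_congr_of_eventuallyEq (v := potential Γ g)
            ((hχK y (Or.inl hy)).mono fun z hz => by simp only [hz, one_mul]), hpL]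
          ring
        · simp [image_eq_zero_of_notMem_tsupport hy]
      have h3 : ∀ y, f y * (χ y * potential Γ g y) = f y * potential Γ g y := fun y => by
        by_cases hy : y ∈ tsupport f
        · rw [(hχK y (Or.inr hy)).self_of_nhds, one_mul]
        · simp [image_eq_zero_of_notMem_tsupport hy]
      simp only [h2, h3] at h1
      rw [integral_neg, neg_inj, ← h.integral_potential_mul hsup hf hfs hg.continuous hgs] at h1
      have hi : ∀ w : EuclideanSpace ℝ (Fin n) → ℝ, Continuous w →
          Integrable fun y => g y * w y := fun w hw =>
        (hg.continuous.mul hw).integrable_of_hasCompactSupport hgs.mul_right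
      simp only [smul_eq_mul, mul_sub]
      rw [integral_sub (hi u hu) (hi _ hUc), h1, sub_eq_zero]
      simp only [mul_comm]
    have hae := ae_eq_zero_of_integral_contDiff_smul_eq_zero (μ := volume)
      hv.locallyIntegrable hzero
    have heq := (hv.ae_eq_iff_eq volume (continuous_const (y := (0 : ℝ)))).1 hae
    exact funext fun y => sub_eq_zero.1 (congrFun heq y)
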